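/- Independence of the generators of a GCQC stabilizer: In the GCQC setup, the sum S_I + φ₁(W₁) + ⋯ + φ_m(W_m) ⊆ (V_n)^N is direct: if G + φ₁(u₁) + ⋯ + φ_m(u_m) = 0 with G ∈ S_I and u_i ∈ W_i for each i, then G = 0 and u₁ = ⋯ = u_m = 0. In particular every replacement map φ_i is injective, and dim_{𝔽₂}(S_I + φ₁(S_{A₁}) + ⋯ + φ_m(S_{A_m})) = dim S_I + Σ_{i=1}^m dim S_{A_i}. -/

import Mathlib

open Finset

/-- Pauli operators (up to phase) on `n` qubits, as symplectic vectors. -/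
abbrev Pauli (n : ℕ) := Fin n → (ZMod 2) × (ZMod 2)

/-- The outer space `W = (𝔽₂^r × 𝔽₂^r)^N`. -/
abbrev Outer (r N : ℕ) := Fin N → (Fin r → ZMod 2) × (Fin r → ZMod 2)

/-- `N` blocks of `n` qubits each. -/
abbrev PauliB (n N : ℕ) := Fin N → Pauli n

/-- Elementary symplectic form on one qubit. -/
def B0 : LinearMap.BilinForm (ZMod 2) ((ZMod 2) × (ZMod 2)) :=
  LinearMap.mk₂ (ZMod 2) (fun u v => u.1 * v.2 + v.1 * u.2)
    (fun a b v => by simp; ring)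
    (fun c a v => by simp; ring)
    (fun a b v => by simp; ring)
    (fun c a v => by simp; ring)

/-- Sum of a bilinear form over `N` coordinates. -/
def sumForm {M : Type*} [AddCommGroup M] [Module (ZMod 2) M] (N : ℕ)
    (B : LinearMap.BilinForm (ZMod 2) M) :
    LinearMap.BilinForm (ZMod 2) (Fin N → M) :=
  LinearMap.mk₂ (ZMod 2) (fun u v => ∑ j, B (u j) (v j))
    (fun a b v => by simp [Finset.sum_add_distrib])
    (fun c a v => by simp [Finset.mul_sum])
    (fun a b v => by simp [Finset.sum_add_distrib])
    (fun c a v => by simp [Finset.mul_sum])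

/-- Symplectic form on `r`-qubit blocks written as pairs of binary `r`-vectors. -/
def pairForm (r : ℕ) : LinearMap.BilinForm (ZMod 2) ((Fin r → ZMod 2) × (Fin r → ZMod 2)) :=
  LinearMap.mk₂ (ZMod 2) (fun u v => ∑ ℓ, (u.1 ℓ * v.2 ℓ + v.1 ℓ * u.2 ℓ))
    (fun a b v => by rw [← Finset.sum_add_distrib]; refine Finset.sum_congr rfl fun ℓ _ => by simp; ring)
    (fun c a v => by rw [smul_eq_mul, Finset.mul_sum]; refine Finset.sum_congr rfl fun ℓ _ => by simp; ring)
    (fun a b v => by rw [← Finset.sum_add_distrib]; refine Finset.sum_congr rfl fun ℓ _ => by simp; ring)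
    (fun c a v => by rw [smul_eq_mul, Finset.mul_sum]; refine Finset.sum_congr rfl fun ℓ _ => by simp; ring)

/-- Symplectic form on `Pauli n`. -/
def symplF (n : ℕ) : LinearMap.BilinForm (ZMod 2) (Pauli n) := sumForm n B0

/-- Symplectic form on `N` blocks of `n` qubits. -/
def symplFB (n N : ℕ) : LinearMap.BilinForm (ZMod 2) (PauliB n N) := sumForm N (symplF n)

/-- Symplectic form on the outer space `W_i`. -/
def symplFO (r N : ℕ) : LinearMap.BilinForm (ZMod 2) (Outer r N) := sumForm N (pairForm r)

/-- Orthogonal complement of a subspace w.r.t. a bilinear form. -/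
def perp {M : Type*} [AddCommGroup M] [Module (ZMod 2) M]
    (B : LinearMap.BilinForm (ZMod 2) M) (S : Submodule (ZMod 2) M) :
    Submodule (ZMod 2) M where
  carrier := {v | ∀ s ∈ S, B s v = 0}
  add_mem' := fun hu hv s hs => by
    rw [map_add, hu s hs, hv s hs, add_zero]
  zero_mem' := fun s hs => by simp
  smul_mem' := fun c v hv s hs => by
    rw [map_smul, hv s hs, smul_zero]

/-- Generic weight: number of nonzero coordinates. -/
def wgt {N : ℕ} {M : Type*} [Zero M] [DecidableEq M] (v : Fin N → M) : ℕ :=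
  (Finset.univ.filter fun j => v j ≠ 0).card

/-- Symplectic weight on `N` blocks of `n` qubits: number of nonzero qubit positions. -/
def swtB {n N : ℕ} (v : PauliB n N) : ℕ := ∑ j, wgt (v j)

/-- Stabilizer of the subcode `B_i`: `S` together with the logical `z`'s of index `< kk`. -/
def Sstab (n : ℕ) (S : Submodule (ZMod 2) (Pauli n)) (z : ℕ → Pauli n) (kk : ℕ) :
    Submodule (ZMod 2) (Pauli n) :=
  S ⊔ Submodule.span (ZMod 2) (z '' Set.Iio kk)

/-- Span of the logical operators `x_t, z_t` with `a ≤ t < b` (0-based indexing). -/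
def Lspan (n : ℕ) (x z : ℕ → Pauli n) (a b : ℕ) : Submodule (ZMod 2) (Pauli n) :=
  Submodule.span (ZMod 2) ((x '' Set.Ico a b) ∪ (z '' Set.Ico a b))

/-- The block-wise inner stabilizer `S_I`. -/
def SI (n N : ℕ) (S : Submodule (ZMod 2) (Pauli n)) : Submodule (ZMod 2) (PauliB n N) :=
  Submodule.pi (Set.univ : Set (Fin N)) (fun _ => S)

/-- The replacement map `φ` with offset `off`, sending the `ℓ`-th binary coordinates of each
block to the logical operators `x (off+ℓ)`, `z (off+ℓ)` of the inner code. -/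
def phi (n N : ℕ) (x z : ℕ → Pauli n) (off r : ℕ) :
    Outer r N →ₗ[ZMod 2] PauliB n N where
  toFun w := fun j =>
    (∑ ℓ : Fin r, (w j).1 ℓ • x (off + ℓ)) + (∑ ℓ : Fin r, (w j).2 ℓ • z (off + ℓ))
  map_add' := fun a b => by
    funext j
    simp [add_smul, Finset.sum_add_distrib]
    abel
  map_smul' := fun c a => by
    funext j
    simp [mul_smul, Finset.smul_sum, smul_add]

theorem B0_comm (u v : ZMod 2 × ZMod 2) : B0 u v = B0 v u := by
  simp only [B0, LinearMap.mk₂_apply]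
  ring

theorem symplF_comm {n : ℕ} (u v : Pauli n) : symplF n u v = symplF n v u := by
  simp only [symplF, sumForm, LinearMap.mk₂_apply]
  exact Finset.sum_congr rfl fun j _ => B0_comm _ _

/-- A linear functional evaluated on a block of the replacement map. -/
theorem map_phi_apply {n N : ℕ} (x z : ℕ → Pauli n) (off r : ℕ)
    (f : Pauli n →ₗ[ZMod 2] ZMod 2) (w : Outer r N) (j : Fin N) :
    f (phi n N x z off r w j) =
      (∑ ℓ : Fin r, (w j).1 ℓ * f (x (off + ℓ))) + ∑ ℓ : Fin r, (w j).2 ℓ * f (z (off + ℓ)) := by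
  simp [phi]

/-- The dimension of a direct sum of `P` and images of subspaces under injective maps:
`hf` says that the sum of `P` and the images of the `f i` is
direct and that every `f i` is injective. -/
theorem finrank_sup_iSup_map {K V ι : Type*} [Field K] [AddCommGroup V] [Module K V]
    [FiniteDimensional K V] {W : ι → Type*} [∀ i, AddCommGroup (W i)] [∀ i, Module K (W i)]
    (P : Submodule K V) (f : ∀ i, W i →ₗ[K] V) (A : ∀ i, Submodule K (W i)) (s : Finset ι)
    (hf : ∀ G ∈ P, ∀ u : ∀ i, W i, G + ∑ i ∈ s, f i (u i) = 0 → G = 0 ∧ ∀ i ∈ s, u i = 0) :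
    Module.finrank K (P ⊔ ⨆ i ∈ s, (A i).map (f i) : Submodule K V) =
      Module.finrank K P + ∑ i ∈ s, Module.finrank K (A i) := by
  classical
  induction s using Finset.induction_on with
  | empty =>
    have h : ⨆ i ∈ (∅ : Finset ι), (A i).map (f i) = ⊥ := by simp
    rw [h, sup_bot_eq, Finset.sum_empty, add_zero]
  | insert a s ha ih =>
    have split (w : W a) (u : ∀ i, W i) :
        ∑ i ∈ insert a s, f i (Function.update u a w i) = f a w + ∑ i ∈ s, f i (u i) := by
      rw [Finset.sum_insert ha, Function.update_self]
      congr 1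
      refine Finset.sum_congr rfl fun i hi => ?_
      rw [Function.update_of_ne (ne_of_mem_of_not_mem hi ha)]
    have key (G : V) (hG : G ∈ P) (w : W a) (u : ∀ i, W i)
        (h : G + (f a w + ∑ i ∈ s, f i (u i)) = 0) : G = 0 ∧ w = 0 ∧ ∀ i ∈ s, u i = 0 := by
      obtain ⟨h0, h1⟩ := hf G hG (Function.update u a w) (by rw [split, h])
      refine ⟨h0, by simpa using h1 a (Finset.mem_insert_self a s), fun i hi => ?_⟩
      have := h1 i (Finset.mem_insert_of_mem hi)
      rwa [Function.update_of_ne (ne_of_mem_of_not_mem hi ha)] at this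
    have hs := ih fun G hG u h => by
      obtain ⟨h0, -, h1⟩ := key G hG 0 u (by simpa using h)
      exact ⟨h0, h1⟩
    have hinj : Function.Injective (f a) := by
      rw [injective_iff_map_eq_zero]
      intro w hw
      exact (key 0 P.zero_mem w 0 (by simp [hw])).2.1
    have hdisj : (A a).map (f a) ⊓ (P ⊔ ⨆ i ∈ s, (A i).map (f i)) = ⊥ := by
      rw [eq_bot_iff]
      rintro _ ⟨⟨w, -, rfl⟩, hv⟩
      obtain ⟨G, hG, y, hy, hGy⟩ := Submodule.mem_sup.1 hv
      obtain ⟨μ, rfl⟩ := (Submodule.mem_iSup_finset_iff_exists_sum _ _).1 hy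
      choose u hu using fun i => (Submodule.mem_map.1 (μ i).2)
      have := (key G hG (-w) u (by
        rw [Finset.sum_congr rfl fun i _ => (hu i).2, map_neg, ← hGy]
        abel)).2.1
      rw [neg_eq_zero] at this
      simp [this]
    have hdim := Submodule.finrank_sup_add_finrank_inf_eq ((A a).map (f a))
      (P ⊔ ⨆ i ∈ s, (A i).map (f i))
    rw [hdisj, finrank_bot, add_zero, hs, ← ((A a).equivMapOfInjective (f a) hinj).finrank_eq] at hdim
    rw [Finset.iSup_insert, sup_left_comm, hdim, Finset.sum_insert ha]
    ring

theorem le_of_forall_succ_lt {m : ℕ} {k : ℕ → ℕ} (hk : ∀ i, 1 ≤ i → i ≤ m → k (i + 1) < k i)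
    {a b : ℕ} (ha : 1 ≤ a) (hab : a ≤ b) (hb : b ≤ m + 1) : k b ≤ k a := by
  induction b, hab using Nat.le_induction with
  | base => exact le_rfl
  | succ b hab ih => exact (hk b (ha.trans hab) (by omega)).le.trans (ih (by omega))

/-- The index ranges `[k 1 - k i, k 1 - k (i + 1))` of a decreasing sequence are disjoint. -/
theorem eq_of_sub_add_eq {m : ℕ} {k : ℕ → ℕ} (hk : ∀ i, 1 ≤ i → i ≤ m → k (i + 1) < k i)
    {i i' : ℕ} (hi : i ∈ Finset.Icc 1 m) (hi' : i' ∈ Finset.Icc 1 m)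
    (ℓ : Fin (k i - k (i + 1))) (ℓ' : Fin (k i' - k (i' + 1)))
    (h : k 1 - k i + ℓ = k 1 - k i' + ℓ') : i = i' := by
  have anti {a b : ℕ} (ha : 1 ≤ a) (hab : a ≤ b) (hb : b ≤ m + 1) : k b ≤ k a :=
    le_of_forall_succ_lt hk ha hab hb
  rw [Finset.mem_Icc] at hi hi'
  have h1 := anti le_rfl hi.1 (by omega)
  have h2 := anti le_rfl hi'.1 (by omega)
  have := ℓ.2
  have := ℓ'.2
  rcases lt_trichotomy i i' with hlt | heq | hlt
  · have := anti (a := i + 1) (by omega) hlt (by omega)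
    omega
  · exact heq
  · have := anti (a := i' + 1) (by omega) hlt (by omega)
    omega

/-- Extracting the coefficient of index `k 1 - k i + ℓ` from coefficients distributed over the
index ranges `[k 1 - k i, k 1 - k (i + 1))`. -/
theorem sum_sum_mul_ite_eq {R : Type*} [NonAssocSemiring R] {m : ℕ} {k : ℕ → ℕ}
    (hk : ∀ i, 1 ≤ i → i ≤ m → k (i + 1) < k i)
    (c : ∀ i, Fin (k i - k (i + 1)) → R) {i : ℕ} (hi : i ∈ Finset.Icc 1 m)
    (ℓ : Fin (k i - k (i + 1))) :
    ∑ i' ∈ Finset.Icc 1 m, ∑ ℓ' : Fin (k i' - k (i' + 1)),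
      c i' ℓ' * (if k 1 - k i' + ℓ' = k 1 - k i + ℓ then 1 else 0) = c i ℓ := by
  rw [Finset.sum_eq_single_of_mem i hi, Finset.sum_eq_single_of_mem ℓ (Finset.mem_univ ℓ)]
  · simp
  · intro ℓ' _ hne
    rw [if_neg (fun h => hne (Fin.ext (by omega))), mul_zero]
  · intro i' hi' hne
    refine Finset.sum_eq_zero fun ℓ' _ => ?_
    rw [if_neg (fun h => hne (eq_of_sub_add_eq hk hi' hi ℓ' ℓ h)), mul_zero]

/-- Independence of the generators of a GCQC stabilizer: the sum
`S_I + φ_1(W_1) + ⋯ + φ_m(W_m)` is direct, each `φ_i` is injective, and the dimension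
of the GCQC stabilizer is the sum of the dimensions of its constituents. -/
theorem gcqc_independence
    (n N m : ℕ) (hm : 1 ≤ m)
    (k : ℕ → ℕ) (hk : ∀ i, 1 ≤ i → i ≤ m → k (i + 1) < k i) (hklast : k (m + 1) = 0)
    (hkn : k 1 ≤ n)
    (S : Submodule (ZMod 2) (Pauli n))
    (hSorth : S ≤ perp (symplF n) S)
    (hSdim : Module.finrank (ZMod 2) S = n - k 1)
    (x z : ℕ → Pauli n)
    (hxS : ∀ t < k 1, x t ∈ perp (symplF n) S)
    (hzS : ∀ t < k 1, z t ∈ perp (symplF n) S)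
    (hxx : ∀ s < k 1, ∀ t < k 1, symplF n (x s) (x t) = 0)
    (hzz : ∀ s < k 1, ∀ t < k 1, symplF n (z s) (z t) = 0)
    (hxz : ∀ s < k 1, ∀ t < k 1, symplF n (x s) (z t) = if s = t then 1 else 0)
    (hdual : perp (symplF n) S = S ⊔ Lspan n x z 0 (k 1))
    (hdisj : Disjoint S (Lspan n x z 0 (k 1)))
    (SA : ∀ i : ℕ, Submodule (ZMod 2) (Outer (k i - k (i + 1)) N)) :
    (∀ G ∈ SI n N S, ∀ u : (i : ℕ) → Outer (k i - k (i + 1)) N,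
        G + ∑ i ∈ Finset.Icc 1 m, phi n N x z (k 1 - k i) (k i - k (i + 1)) (u i) = 0 →
        G = 0 ∧ ∀ i ∈ Finset.Icc 1 m, u i = 0)
    ∧ (∀ i, 1 ≤ i → i ≤ m →
        Function.Injective (phi n N x z (k 1 - k i) (k i - k (i + 1))))
    ∧ Module.finrank (ZMod 2)
        ((SI n N S ⊔ ⨆ i ∈ Finset.Icc 1 m,
          Submodule.map (phi n N x z (k 1 - k i) (k i - k (i + 1))) (SA i)
          : Submodule (ZMod 2) (PauliB n N)))
      = Module.finrank (ZMod 2) (SI n N S)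
        + ∑ i ∈ Finset.Icc 1 m, Module.finrank (ZMod 2) (SA i) := by
  have lt_k1 {i : ℕ} (hi : i ∈ Finset.Icc 1 m) (ℓ : Fin (k i - k (i + 1))) :
      k 1 - k i + ℓ < k 1 := by
    rw [Finset.mem_Icc] at hi
    have := le_of_forall_succ_lt hk le_rfl hi.1 (by omega)
    have := ℓ.2
    omega
  have direct : ∀ G ∈ SI n N S, ∀ u : (i : ℕ) → Outer (k i - k (i + 1)) N,
      G + ∑ i ∈ Finset.Icc 1 m, phi n N x z (k 1 - k i) (k i - k (i + 1)) (u i) = 0 →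
      G = 0 ∧ ∀ i ∈ Finset.Icc 1 m, u i = 0 := by
    intro G hG u h
    have pairing (j : Fin N) (f : Pauli n →ₗ[ZMod 2] ZMod 2) (hfS : ∀ s ∈ S, f s = 0) :
        ∑ i ∈ Finset.Icc 1 m, f (phi n N x z (k 1 - k i) (k i - k (i + 1)) (u i) j) = 0 := by
      have := congrArg f (congrFun h j)
      rwa [Pi.add_apply, map_add, hfS _ (hG j (Set.mem_univ j)), zero_add, Finset.sum_apply,
        map_sum, Pi.zero_apply, map_zero] at this
    have hu : ∀ i ∈ Finset.Icc 1 m, u i = 0 := by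
      intro i hi
      funext j
      refine Prod.ext (funext fun ℓ => ?_) (funext fun ℓ => ?_)
      · have hp := pairing j ((symplF n).flip (z (k 1 - k i + ℓ)))
          fun s hs => hzS _ (lt_k1 hi ℓ) s hs
        rw [← sum_sum_mul_ite_eq hk (fun i => (u i j).1) hi ℓ]
        refine Eq.trans (Finset.sum_congr rfl fun i' hi' => ?_) hp
        rw [map_phi_apply]
        simp only [LinearMap.BilinForm.flip_apply, hxz _ (lt_k1 hi' _) _ (lt_k1 hi ℓ),
          hzz _ (lt_k1 hi' _) _ (lt_k1 hi ℓ), mul_zero, Finset.sum_const_zero, add_zero]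
      · have hp := pairing j (symplF n (x (k 1 - k i + ℓ)))
          fun s hs => (symplF_comm _ _).trans (hxS _ (lt_k1 hi ℓ) s hs)
        rw [← sum_sum_mul_ite_eq hk (fun i => (u i j).2) hi ℓ]
        refine Eq.trans (Finset.sum_congr rfl fun i' hi' => ?_) hp
        rw [map_phi_apply]
        simp only [hxz _ (lt_k1 hi ℓ) _ (lt_k1 hi' _), hxx _ (lt_k1 hi ℓ) _ (lt_k1 hi' _),
          mul_zero, Finset.sum_const_zero, zero_add, eq_comm]
    refine ⟨?_, hu⟩
    rwa [Finset.sum_eq_zero fun i hi => by rw [hu i hi, map_zero], add_zero] at h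
  refine ⟨direct, fun i h1 hm => ?_, finrank_sup_iSup_map _ _ SA _ direct⟩
  rw [injective_iff_map_eq_zero]
  intro w hw
  have hi := Finset.mem_Icc.2 ⟨h1, hm⟩
  have := (direct 0 (Submodule.zero_mem _) (Pi.single i w) (by
    rw [zero_add, Finset.sum_eq_single_of_mem i hi, Pi.single_eq_same, hw]
    intro i' _ hne
    rw [Pi.single_eq_of_ne hne, map_zero])).2 i hi
  rwa [Pi.single_eq_same] at this
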